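/- arXiv:2212.08589 — 5 statements merged into one kernel-verified Lean document; each statement's English description precedes it below -/
import Mathlib

section
/- (Algebraic core of Theorem 3, 'if' direction.) Let A ∈ ℂ^{n×n}, B ∈ ℂ^{n×1}, C ∈ ℂ^{1×n}, S, Q ∈ ℂ^{ν×ν}, L ∈ ℂ^{1×ν}, R ∈ ℂ^{ν×1}, and let Π ∈ ℂ^{n×ν} and Υ ∈ ℂ^{ν×n} satisfy AΠ + BL = ΠS and QΥ = ΥA + RC. Suppose ΥΠ is invertible and set H = CΠ(ΥΠ)^{-1}. Then the reduced-order model matrices F = Q − RH, G = ΥB and H satisfy the moment-matching relations: F(ΥΠ) + G L = (ΥΠ) S and H(ΥΠ) = CΠ (so P = ΥΠ solves the reduced Sylvester equation at S with HP = CΠ), and Q·I = I·F + RH with I·G = ΥB (so Y = I solves the reduced Sylvester equation at Q with YG = ΥB). -/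
open Matrix

/-- algebraic core of Theorem 3, 'if' direction: with
`H = CΠ(ΥΠ)⁻¹`, `F = Q − RH`, `G = ΥB`, the reduced-order model satisfies the
moment-matching Sylvester relations at `S` (with solution `P = ΥΠ`) and at `Q`
(with solution `Y = I`). -/
theorem stmt13 {n ν : ℕ}
    (A : Matrix (Fin n) (Fin n) ℂ) (B : Matrix (Fin n) (Fin 1) ℂ)
    (C : Matrix (Fin 1) (Fin n) ℂ)
    (S Q : Matrix (Fin ν) (Fin ν) ℂ)
    (L : Matrix (Fin 1) (Fin ν) ℂ) (R : Matrix (Fin ν) (Fin 1) ℂ)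
    (Pmat : Matrix (Fin n) (Fin ν) ℂ) (Ups : Matrix (Fin ν) (Fin n) ℂ)
    (hSylP : A * Pmat + B * L = Pmat * S)
    (hSylU : Q * Ups = Ups * A + R * C)
    (hinv : IsUnit (Ups * Pmat))
    (H : Matrix (Fin 1) (Fin ν) ℂ) (hH : H = C * Pmat * (Ups * Pmat)⁻¹)
    (F : Matrix (Fin ν) (Fin ν) ℂ) (hF : F = Q - R * H)
    (G : Matrix (Fin ν) (Fin 1) ℂ) (hG : G = Ups * B) :
    F * (Ups * Pmat) + G * L = (Ups * Pmat) * S ∧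
    H * (Ups * Pmat) = C * Pmat ∧
    Q * (1 : Matrix (Fin ν) (Fin ν) ℂ) = (1 : Matrix (Fin ν) (Fin ν) ℂ) * F + R * H ∧
    (1 : Matrix (Fin ν) (Fin ν) ℂ) * G = Ups * B := by
  have hHP : H * (Ups * Pmat) = C * Pmat := by
    rw [hH, Matrix.mul_assoc, Matrix.nonsing_inv_mul _ ((Matrix.isUnit_iff_isUnit_det _).mp hinv),
      Matrix.mul_one]
  refine ⟨?_, hHP, by simp [hF], by rw [Matrix.one_mul, hG]⟩
  calc F * (Ups * Pmat) + G * L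
      = Q * Ups * Pmat - R * (H * (Ups * Pmat)) + Ups * B * L := by
        rw [hF, hG, Matrix.sub_mul, Matrix.mul_assoc R, Matrix.mul_assoc Q]
    _ = Ups * (A * Pmat + B * L) := by
        rw [hHP, hSylU, Matrix.add_mul, Matrix.mul_add]
        simp only [Matrix.mul_assoc, add_sub_cancel_right]
    _ = Ups * Pmat * S := by rw [hSylP, Matrix.mul_assoc]
end

section
/- (Similarity equivalence of the two parameterizations in Theorem 3.) Let Π and Υ satisfy AΠ + BL = ΠS and QΥ = ΥA + RC, suppose ΥΠ is invertible, and set H = CΠ(ΥΠ)^{-1} and G = (ΥΠ)^{-1}ΥB. Then the models ξ̇ = (Q − RH)ξ + ΥB u, ψ = Hξ and ξ̇ = (S − GL)ξ + G u, ψ = CΠ ξ are related by the similarity transformation T = ΥΠ: namely (ΥΠ)(S − GL)(ΥΠ)^{-1} = Q − RH, (ΥΠ) G = ΥB, and (CΠ)(ΥΠ)^{-1} = H. -/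
open Matrix

/-- similarity equivalence of the two parameterizations in
Theorem 3: with `H = CΠ(ΥΠ)⁻¹` and `G = (ΥΠ)⁻¹ΥB`, the transformation
`T = ΥΠ` relates the two reduced models:
`(ΥΠ)(S − GL)(ΥΠ)⁻¹ = Q − RH`, `(ΥΠ)G = ΥB`, `(CΠ)(ΥΠ)⁻¹ = H`. -/
theorem stmt14 {n ν : ℕ}
    (A : Matrix (Fin n) (Fin n) ℂ) (B : Matrix (Fin n) (Fin 1) ℂ)
    (C : Matrix (Fin 1) (Fin n) ℂ)
    (S Q : Matrix (Fin ν) (Fin ν) ℂ)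
    (L : Matrix (Fin 1) (Fin ν) ℂ) (R : Matrix (Fin ν) (Fin 1) ℂ)
    (Pmat : Matrix (Fin n) (Fin ν) ℂ) (Ups : Matrix (Fin ν) (Fin n) ℂ)
    (hSylP : A * Pmat + B * L = Pmat * S)
    (hSylU : Q * Ups = Ups * A + R * C)
    (hinv : IsUnit (Ups * Pmat))
    (H : Matrix (Fin 1) (Fin ν) ℂ) (hH : H = C * Pmat * (Ups * Pmat)⁻¹)
    (G : Matrix (Fin ν) (Fin 1) ℂ) (hG : G = (Ups * Pmat)⁻¹ * (Ups * B)) :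
    (Ups * Pmat) * (S - G * L) * (Ups * Pmat)⁻¹ = Q - R * H ∧
    (Ups * Pmat) * G = Ups * B ∧
    (C * Pmat) * (Ups * Pmat)⁻¹ = H := by
  have hdet : IsUnit (Ups * Pmat).det := (Matrix.isUnit_iff_isUnit_det _).mp hinv
  have hTG : (Ups * Pmat) * G = Ups * B := by
    rw [hG, Matrix.mul_nonsing_inv_cancel_left _ _ hdet]
  have hleft : (Ups * Pmat) * (S - G * L) = Ups * A * Pmat := by
    rw [Matrix.mul_sub, ← Matrix.mul_assoc (Ups * Pmat) G L, hTG, Matrix.mul_assoc Ups Pmat S,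
      ← hSylP, Matrix.mul_add, Matrix.mul_assoc Ups B L, add_sub_cancel_right, Matrix.mul_assoc]
  have hright : Ups * A * Pmat = Q * (Ups * Pmat) - R * (C * Pmat) := by
    rw [← Matrix.mul_assoc Q, hSylU, Matrix.add_mul, Matrix.mul_assoc R C Pmat,
      add_sub_cancel_right]
  refine ⟨?_, hTG, hH.symm⟩
  rw [hleft, hright, Matrix.sub_mul, Matrix.mul_nonsing_inv_cancel_right _ _ hdet,
    Matrix.mul_assoc R, ← hH]
end

section
/- (Moment characterization via ΥB.) Let A ∈ ℂ^{n×n}, B ∈ ℂ^{n×1}, C ∈ ℂ^{1×n}, let q₁,…,q_ν ∈ ℂ with q_i ∉ σ(A) for all i, let Q = diag(q₁,…,q_ν) and R = [1 1 … 1]ᵀ ∈ ℂ^{ν×1}. If Υ ∈ ℂ^{ν×n} satisfies QΥ = ΥA + RC, then the i-th row of Υ equals C(q_i I − A)^{-1} for every i, and consequently the i-th entry of ΥB equals the 0-moment η₀(q_i) = C(q_i I − A)^{-1} B = W(q_i). -/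
open Matrix

/-- moment characterization via `ΥB`: with `Q = diag(q₁,…,q_ν)`,
`R = [1 … 1]ᵀ` and `QΥ = ΥA + RC`, the `i`-th row of `Υ` is `C(q_i I − A)⁻¹`
and the `i`-th entry of `ΥB` is the 0-moment `C(q_i I − A)⁻¹B`. -/
theorem stmt16 {n ν : ℕ}
    (A : Matrix (Fin n) (Fin n) ℂ) (B : Matrix (Fin n) (Fin 1) ℂ)
    (C : Matrix (Fin 1) (Fin n) ℂ)
    (q : Fin ν → ℂ) (hq : ∀ i, q i ∉ spectrum ℂ A)
    (Q : Matrix (Fin ν) (Fin ν) ℂ) (hQ : Q = Matrix.diagonal q)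
    (R : Matrix (Fin ν) (Fin 1) ℂ) (hR : R = Matrix.of fun _ _ => (1 : ℂ))
    (Ups : Matrix (Fin ν) (Fin n) ℂ)
    (hSyl : Q * Ups = Ups * A + R * C) :
    (∀ i : Fin ν, ∀ j : Fin n,
      Ups i j = (C * (q i • (1 : Matrix (Fin n) (Fin n) ℂ) - A)⁻¹) 0 j) ∧
    (∀ i : Fin ν,
      (Ups * B) i 0 = (C * (q i • (1 : Matrix (Fin n) (Fin n) ℂ) - A)⁻¹ * B) 0 0) := by
  subst hQ hR
  have hrow : ∀ i : Fin ν, Matrix.of (fun _ : Fin 1 => Ups i) =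
      C * (q i • (1 : Matrix (Fin n) (Fin n) ℂ) - A)⁻¹ := by
    intro i
    have hunit : IsUnit (q i • (1 : Matrix (Fin n) (Fin n) ℂ) - A).det := by
      rw [← Matrix.isUnit_iff_isUnit_det, ← Algebra.algebraMap_eq_smul_one]
      exact spectrum.notMem_iff.mp (hq i)
    have hmul : Matrix.of (fun _ : Fin 1 => Ups i) *
        (q i • (1 : Matrix (Fin n) (Fin n) ℂ) - A) = C := by
      ext k j
      have hij := congrFun (congrFun hSyl i) j
      rw [Matrix.diagonal_mul, Matrix.add_apply] at hij
      rw [Subsingleton.elim k 0, Matrix.mul_sub, Matrix.mul_smul, Matrix.mul_one]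
      simp only [Matrix.mul_apply, Matrix.sub_apply, Matrix.smul_apply, Matrix.of_apply,
        Fin.sum_univ_one, one_mul, smul_eq_mul] at hij ⊢
      rw [hij, add_sub_cancel_left]
    rw [← hmul, Matrix.mul_nonsing_inv_cancel_right _ _ hunit]
  refine ⟨fun i j => ?_, fun i => ?_⟩
  · rw [← hrow i, Matrix.of_apply]
  · rw [← hrow i]
    simp only [Matrix.mul_apply, Matrix.of_apply]
end

section
/- (Interpolation of the two-sided reduced model at σ(S).) Let A ∈ ℂ^{n×n}, B ∈ ℂ^{n×1}, C ∈ ℂ^{1×n}, let S = diag(s₁,…,s_ν) with s_i ∉ σ(A) and L = [1 … 1] ∈ ℂ^{1×ν}, and let Q ∈ ℂ^{ν×ν}, R ∈ ℂ^{ν×1}. Let Π satisfy AΠ + BL = ΠS and Υ satisfy QΥ = ΥA + RC, suppose ΥΠ is invertible, and set H = CΠ(ΥΠ)^{-1} and F = Q − RH. Then for every i such that s_i ∉ σ(F), the transfer function of the reduced model satisfies H (s_i I − F)^{-1} ΥB = C (s_i I − A)^{-1} B. -/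
open Matrix

/-- interpolation of the two-sided reduced model at `σ(S)`:
with `H = CΠ(ΥΠ)⁻¹` and `F = Q − RH`, for every `i` with `s_i ∉ σ(F)` the
reduced transfer function matches the full one at `s_i`:
`H(s_i I − F)⁻¹ΥB = C(s_i I − A)⁻¹B`. -/
theorem stmt17 {n ν : ℕ}
    (A : Matrix (Fin n) (Fin n) ℂ) (B : Matrix (Fin n) (Fin 1) ℂ)
    (C : Matrix (Fin 1) (Fin n) ℂ)
    (s : Fin ν → ℂ) (hs : ∀ i, s i ∉ spectrum ℂ A)
    (S : Matrix (Fin ν) (Fin ν) ℂ) (hS : S = Matrix.diagonal s)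
    (L : Matrix (Fin 1) (Fin ν) ℂ) (hL : L = Matrix.of fun _ _ => (1 : ℂ))
    (Q : Matrix (Fin ν) (Fin ν) ℂ) (R : Matrix (Fin ν) (Fin 1) ℂ)
    (Pmat : Matrix (Fin n) (Fin ν) ℂ) (Ups : Matrix (Fin ν) (Fin n) ℂ)
    (hSylP : A * Pmat + B * L = Pmat * S)
    (hSylU : Q * Ups = Ups * A + R * C)
    (hinv : IsUnit (Ups * Pmat))
    (H : Matrix (Fin 1) (Fin ν) ℂ) (hH : H = C * Pmat * (Ups * Pmat)⁻¹)
    (F : Matrix (Fin ν) (Fin ν) ℂ) (hF : F = Q - R * H) :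
    ∀ i : Fin ν, s i ∉ spectrum ℂ F →
      H * (s i • (1 : Matrix (Fin ν) (Fin ν) ℂ) - F)⁻¹ * (Ups * B) =
        C * (s i • (1 : Matrix (Fin n) (Fin n) ℂ) - A)⁻¹ * B := by
  intro i hi
  have hA : IsUnit (s i • (1 : Matrix (Fin n) (Fin n) ℂ) - A).det := by
    simpa [spectrum.mem_iff, Algebra.algebraMap_eq_smul_one, Matrix.isUnit_iff_isUnit_det]
      using hs i
  have hF' : IsUnit (s i • (1 : Matrix (Fin ν) (Fin ν) ℂ) - F).det := by
    simpa [spectrum.mem_iff, Algebra.algebraMap_eq_smul_one, Matrix.isUnit_iff_isUnit_det]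
      using hi
  have hU : IsUnit (Ups * Pmat).det := (Matrix.isUnit_iff_isUnit_det _).1 hinv
  obtain ⟨E, hSE, hLE⟩ : ∃ E : Matrix (Fin ν) (Fin 1) ℂ, S * E = s i • E ∧ L * E = 1 := by
    refine ⟨Matrix.single i 0 1, ?_, ?_⟩
    · subst hS
      ext j k
      by_cases h : i = j <;> simp [Matrix.diagonal_mul, Matrix.single_apply, h]
    · subst hL
      ext j k
      simp [Matrix.mul_apply, Matrix.single_apply, Matrix.one_apply, Subsingleton.elim j k,
        Subsingleton.elim 0 k]
  have hB : (s i • (1 : Matrix (Fin n) (Fin n) ℂ) - A) * (Pmat * E) = B := by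
    have h := congrArg (· * E) hSylP
    simp only [Matrix.add_mul, Matrix.mul_assoc, hSE, hLE, Matrix.mul_one, Matrix.mul_smul] at h
    rw [Matrix.sub_mul, Matrix.smul_mul, Matrix.one_mul, ← h]
    abel
  have hHU : H * (Ups * Pmat) = C * Pmat := by
    rw [hH, Matrix.nonsing_inv_mul_cancel_right _ _ hU]
  have hUB : (s i • (1 : Matrix (Fin ν) (Fin ν) ℂ) - F) * (Ups * Pmat * E) = Ups * B := by
    have h₁ : Q * (Ups * Pmat * E) = Ups * (A * (Pmat * E)) + R * (C * (Pmat * E)) := by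
      rw [Matrix.mul_assoc Ups, ← Matrix.mul_assoc Q, hSylU]
      simp only [Matrix.add_mul, Matrix.mul_assoc]
    have h₂ : R * H * (Ups * Pmat * E) = R * (C * (Pmat * E)) := by
      rw [Matrix.mul_assoc R, ← Matrix.mul_assoc H, hHU, Matrix.mul_assoc C]
    rw [hF, Matrix.sub_mul, Matrix.sub_mul, h₁, h₂, ← hB, Matrix.sub_mul, Matrix.mul_sub]
    simp only [Matrix.smul_mul, Matrix.one_mul, Matrix.mul_smul, Matrix.mul_assoc]
    abel
  rw [← hUB, Matrix.mul_assoc H, Matrix.nonsing_inv_mul_cancel_left _ _ hF', ← Matrix.mul_assoc H,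
    hHU, Matrix.mul_assoc C _ B, ← hB,
    Matrix.nonsing_inv_mul_cancel_left _ _ hA, Matrix.mul_assoc]
end

section
/- (Interpolation at σ(Q) for the whole family of models.) Let A ∈ ℂ^{n×n}, B ∈ ℂ^{n×1}, C ∈ ℂ^{1×n}, let Q = diag(q₁,…,q_ν) with q_i ∉ σ(A) and R = [1 … 1]ᵀ ∈ ℂ^{ν×1}, and let Υ ∈ ℂ^{ν×n} satisfy QΥ = ΥA + RC. Then for every H ∈ ℂ^{1×ν} and every i such that q_i ∉ σ(Q − RH), the model ξ̇ = (Q − RH)ξ + ΥB u, ψ = Hξ satisfies H (q_i I − (Q − RH))^{-1} ΥB = C (q_i I − A)^{-1} B. -/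
open Matrix

/-- If `μ` is not in the spectrum of `M`, then `μ • 1 - M` has invertible determinant. -/
theorem isUnit_det_smul_one_sub {m : ℕ} {M : Matrix (Fin m) (Fin m) ℂ} {μ : ℂ}
    (h : μ ∉ spectrum ℂ M) :
    IsUnit (μ • (1 : Matrix (Fin m) (Fin m) ℂ) - M).det := by
  rw [spectrum.notMem_iff, Algebra.algebraMap_eq_smul_one] at h
  exact (Matrix.isUnit_iff_isUnit_det _).1 h

/-- If `E` is a left eigenvector of `Q` for `μ` with `E * R = 1`, then every model
`(Q - R * H, Ups * B, H)` built from a solution of the Sylvester equation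
`Q * Ups = Ups * A + R * C` interpolates the transfer function of `(A, B, C)` at `μ`. -/
theorem transfer_eq_of_left_eigenvector {n ν : ℕ}
    {A : Matrix (Fin n) (Fin n) ℂ} (B : Matrix (Fin n) (Fin 1) ℂ)
    {C : Matrix (Fin 1) (Fin n) ℂ} {Q : Matrix (Fin ν) (Fin ν) ℂ}
    {R : Matrix (Fin ν) (Fin 1) ℂ} {Ups : Matrix (Fin ν) (Fin n) ℂ}
    (hSyl : Q * Ups = Ups * A + R * C) {μ : ℂ} {E : Matrix (Fin 1) (Fin ν) ℂ}
    (hEQ : E * Q = μ • E) (hER : E * R = 1) (hA : μ ∉ spectrum ℂ A)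
    (H : Matrix (Fin 1) (Fin ν) ℂ) (hH : μ ∉ spectrum ℂ (Q - R * H)) :
    H * (μ • (1 : Matrix (Fin ν) (Fin ν) ℂ) - (Q - R * H))⁻¹ * (Ups * B) =
      C * (μ • (1 : Matrix (Fin n) (Fin n) ℂ) - A)⁻¹ * B := by
  have hEM : E * (μ • (1 : Matrix (Fin ν) (Fin ν) ℂ) - (Q - R * H)) = H := by
    rw [Matrix.mul_sub, Matrix.mul_sub, ← Matrix.mul_assoc E R H, hEQ, hER]
    simp
  have hEU : E * Ups * (μ • (1 : Matrix (Fin n) (Fin n) ℂ) - A) = C := by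
    have h := congrArg (E * ·) hSyl
    simp only [Matrix.mul_add, ← Matrix.mul_assoc, hEQ, hER, Matrix.one_mul,
      Matrix.smul_mul] at h
    rw [Matrix.mul_sub, Matrix.mul_smul, Matrix.mul_one, h, add_sub_cancel_left]
  have h₁ := Matrix.mul_nonsing_inv_cancel_right _ E (isUnit_det_smul_one_sub hH)
  have h₂ := Matrix.mul_nonsing_inv_cancel_right _ (E * Ups) (isUnit_det_smul_one_sub hA)
  rw [hEM] at h₁
  rw [hEU] at h₂
  rw [h₁, h₂, Matrix.mul_assoc]

/-- interpolation at `σ(Q)` for the whole family of models: with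
`Q = diag(q₁,…,q_ν)`, `R = [1 … 1]ᵀ` and `QΥ = ΥA + RC`, for every `H` and
every `i` with `q_i ∉ σ(Q − RH)`,
`H(q_i I − (Q − RH))⁻¹ΥB = C(q_i I − A)⁻¹B`. -/
theorem stmt18 {n ν : ℕ}
    (A : Matrix (Fin n) (Fin n) ℂ) (B : Matrix (Fin n) (Fin 1) ℂ)
    (C : Matrix (Fin 1) (Fin n) ℂ)
    (q : Fin ν → ℂ) (hq : ∀ i, q i ∉ spectrum ℂ A)
    (Q : Matrix (Fin ν) (Fin ν) ℂ) (hQ : Q = Matrix.diagonal q)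
    (R : Matrix (Fin ν) (Fin 1) ℂ) (hR : R = Matrix.of fun _ _ => (1 : ℂ))
    (Ups : Matrix (Fin ν) (Fin n) ℂ)
    (hSyl : Q * Ups = Ups * A + R * C) :
    ∀ (H : Matrix (Fin 1) (Fin ν) ℂ) (i : Fin ν),
      q i ∉ spectrum ℂ (Q - R * H) →
      H * (q i • (1 : Matrix (Fin ν) (Fin ν) ℂ) - (Q - R * H))⁻¹ * (Ups * B) =
        C * (q i • (1 : Matrix (Fin n) (Fin n) ℂ) - A)⁻¹ * B := by
  intro H i hi
  subst hQ hR
  refine transfer_eq_of_left_eigenvector B hSyl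
    (E := Matrix.of fun _ j => (Pi.single i 1 : Fin ν → ℂ) j) ?_ ?_ (hq i) H hi
  · ext a j
    by_cases h : j = i
    · subst h
      simp [Matrix.mul_diagonal]
    · simp [Matrix.mul_diagonal, h]
  · ext a b
    obtain rfl := Subsingleton.elim a b
    simp [Matrix.mul_apply]
end
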